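/- arXiv:1809.01128 — 2 statements merged into one kernel-verified Lean document; each statement's English description precedes it below -/
import Mathlib

section
/- Let k ≥ 1 and let G be a connected simple graph containing an odd cycle C = v1v2⋯v_{2k+1}v1 such that G − E(C) has exactly 2k+1 components; let Gi denote the component of G − E(C) containing vi, with mi = |E(Gi)|. Let G' = G − Σ_{i=2}^{2k+1} Σ_{w ∈ N_{Gi}(vi)} w vi + Σ_{i=2}^{2k+1} Σ_{w ∈ N_{Gi}(vi)} w v1, i.e., every edge of each branch Gi (2 ≤ i ≤ 2k+1) incident with vi is replaced by the corresponding edge incident with v1. Then W_e(G') ≤ W_e(G), with equality if and only if at most one of the branches G1, …, G_{2k+1} contains an edge (that is, the cycle C is an end-block of G, so that G ≅ G'). -/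
open SimpleGraph Finset
open scoped Classical

/-- The distance `d_G(f,g)` between two edges: `0` if they coincide, otherwise the minimum
distance between endpoints plus one (i.e. the distance in the line graph). -/
noncomputable def eDist {V : Type*} (G : SimpleGraph V) (e f : Sym2 V) : ℕ :=
  if e = f then 0 else sInf {n : ℕ | ∃ u ∈ e, ∃ w ∈ f, G.dist u w = n} + 1

/-- The distance `d_G(v,f)` between a vertex and an edge: the minimum distance to an endpoint. -/
noncomputable def vDist {V : Type*} (G : SimpleGraph V) (v : V) (e : Sym2 V) : ℕ :=
  sInf {n : ℕ | ∃ u ∈ e, G.dist v u = n}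

/-- The edge-Wiener index `W_e(G)`: the sum of `eDist` over unordered pairs of edges. -/
noncomputable def edgeWiener {V : Type*} [Fintype V] (G : SimpleGraph V) : ℕ :=
  (∑ e ∈ G.edgeFinset, ∑ f ∈ G.edgeFinset, eDist G e f) / 2

namespace EW

/-- There is a walk of length at most `n`. -/
def Wk {V : Type*} (K : SimpleGraph V) (x y : V) (n : ℕ) : Prop :=
  ∃ w : K.Walk x y, w.length ≤ n

theorem Wk.trans {V : Type*} {K : SimpleGraph V} {x y z : V} {a b : ℕ}
    (h1 : Wk K x y a) (h2 : Wk K y z b) : Wk K x z (a + b) := by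
  obtain ⟨w1, h1⟩ := h1
  obtain ⟨w2, h2⟩ := h2
  exact ⟨w1.append w2, by rw [Walk.length_append]; omega⟩

theorem Wk.symm {V : Type*} {K : SimpleGraph V} {x y : V} {a : ℕ}
    (h1 : Wk K x y a) : Wk K y x a := by
  obtain ⟨w1, h1⟩ := h1
  exact ⟨w1.reverse, by rw [Walk.length_reverse]; omega⟩

theorem Wk.map {V W : Type*} {K : SimpleGraph V} {L : SimpleGraph W} (f : V → W)
    (hf : ∀ a b, K.Adj a b → L.Adj (f a) (f b)) {x y : V} {a : ℕ}
    (h1 : Wk K x y a) : Wk L (f x) (f y) a := by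
  obtain ⟨w1, h1⟩ := h1
  let g : K →g L := ⟨f, fun {a b} h => hf a b h⟩
  exact ⟨w1.map g, by rw [Walk.length_map]; omega⟩

theorem Wk.of_reach {V : Type*} {K : SimpleGraph V} {x y : V}
    (h1 : K.Reachable x y) : Wk K x y (K.dist x y) := by
  obtain ⟨w, hw⟩ := h1.exists_walk_length_eq_dist
  exact ⟨w, hw.le⟩

theorem lip_walk {V : Type*} {K : SimpleGraph V} (F : V → ℕ)
    (hF : ∀ a b, K.Adj a b → F b ≤ F a + 1) {x y : V} (w : K.Walk x y) :
    F y ≤ F x + w.length := by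
  induction w with
  | nil => simp
  | cons h w ih =>
    have := hF _ _ h
    rw [Walk.length_cons]
    omega

theorem dist_eq {V : Type*} {K : SimpleGraph V} (F : V → ℕ)
    (hF : ∀ a b, K.Adj a b → F b ≤ F a + 1) {x y : V} (hx : F x = 0)
    (hw : Wk K x y (F y)) : K.dist x y = F y := by
  obtain ⟨w, hw⟩ := hw
  apply le_antisymm
  · exact (dist_le w).trans hw
  · obtain ⟨w', hw'⟩ := w.reachable.exists_walk_length_eq_dist
    have := lip_walk F hF w'
    omega

theorem dist_lip {V : Type*} (K : SimpleGraph V) (x : V) (a b : V) (h : K.Adj a b) :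
    K.dist x b ≤ K.dist x a + 1 := by
  by_cases hr : K.Reachable x a
  · obtain ⟨w, hw⟩ := hr.exists_walk_length_eq_dist
    rw [← hw]
    have := dist_le (w.concat h)
    rwa [Walk.length_concat] at this
  · have : ¬ K.Reachable x b := fun h' => hr (h'.trans h.symm.reachable)
    rw [dist_eq_zero_of_not_reachable this]; omega

/-- The cycle on `ZMod n`. -/
def Cyc (n : ℕ) : SimpleGraph (ZMod n) := SimpleGraph.fromRel (fun a b => b = a + 1)

theorem Cyc_adj_succ {n : ℕ} (hn : 3 ≤ n) (a : ZMod n) : (Cyc n).Adj a (a + 1) := by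
  have : Fact (1 < n) := ⟨by omega⟩
  simp [Cyc]

theorem Cyc_reach {n : ℕ} (hn : 3 ≤ n) (a b : ZMod n) : (Cyc n).Reachable a b := by
  have : NeZero n := ⟨by omega⟩
  have key : ∀ m : ℕ, (Cyc n).Reachable 0 (m : ZMod n) := by
    intro m
    induction m with
    | zero => simp
    | succ m ih =>
      rw [Nat.cast_succ]
      exact ih.trans (Cyc_adj_succ hn _).reachable
  have h1 := key a.val
  have h2 := key b.val
  rw [ZMod.natCast_zmod_val] at h1 h2
  exact h1.symm.trans h2

/-- cycle distance -/
noncomputable def cd (n : ℕ) (a b : ZMod n) : ℕ := (Cyc n).dist a b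

theorem cd_self {n : ℕ} (a : ZMod n) : cd n a a = 0 := by simp [cd]

theorem cd_comm {n : ℕ} (a b : ZMod n) : cd n a b = cd n b a := SimpleGraph.dist_comm

theorem cd_pos {n : ℕ} (hn : 3 ≤ n) {a b : ZMod n} (h : a ≠ b) : 0 < cd n a b :=
  (Cyc_reach hn a b).pos_dist_of_ne h

theorem cd_succ {n : ℕ} (hn : 3 ≤ n) (a b : ZMod n) : cd n a (b + 1) ≤ cd n a b + 1 :=
  dist_lip _ _ _ _ (Cyc_adj_succ hn b)

theorem cd_pred {n : ℕ} (hn : 3 ≤ n) (a b : ZMod n) : cd n a b ≤ cd n a (b + 1) + 1 :=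
  dist_lip _ _ _ _ (Cyc_adj_succ hn b).symm

theorem cd_wk {n : ℕ} (hn : 3 ≤ n) (a b : ZMod n) : Wk (Cyc n) a b (cd n a b) :=
  Wk.of_reach (Cyc_reach hn a b)

theorem cd_add_le {n : ℕ} (hn : 3 ≤ n) (a b t : ZMod n) : cd n (a + t) (b + t) ≤ cd n a b := by
  obtain ⟨w, hw⟩ := (cd_wk hn a b).map (L := Cyc n) (fun x => x + t) (by
    intro x y h
    simp only [Cyc, SimpleGraph.fromRel_adj] at h ⊢
    refine ⟨fun h' => h.1 (add_right_cancel h'), ?_⟩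
    rcases h.2 with h | h
    · left; rw [h]; ring
    · right; rw [h]; ring)
  exact (dist_le w).trans hw

theorem cd_add {n : ℕ} (hn : 3 ≤ n) (a b t : ZMod n) : cd n (a + t) (b + t) = cd n a b := by
  apply le_antisymm (cd_add_le hn a b t)
  have := cd_add_le hn (a + t) (b + t) (-t)
  simpa using this

/-- The configuration: branches `H` attached to a cycle `u`. -/
structure Cfg (n : ℕ) (V : Type*) where
  hn : 3 ≤ n
  H : SimpleGraph V
  u : ZMod n → V
  h : V → ZMod n
  hr : ∀ x, H.Reachable (u (h x)) x
  hu : ∀ i, h (u i) = i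
  hadj : ∀ a b, H.Adj a b → h a = h b
  G : SimpleGraph V
  G' : SimpleGraph V
  p : V → V
  hp : ∀ x, p x = if x = u (h x) then u 0 else x
  hG : ∀ a b, G.Adj a b ↔ H.Adj a b ∨ ∃ i, s(a, b) = s(u i, u (i + 1))
  hG' : ∀ a b, G'.Adj a b ↔ (∃ x y, H.Adj x y ∧ a = p x ∧ b = p y) ∨
    ∃ i, s(a, b) = s(u i, u (i + 1))
  hdis : ∀ a b, H.Adj a b → ∀ i, s(a, b) ≠ s(u i, u (i + 1))

variable {n : ℕ} {V : Type*}

theorem Cfg.reach (S : Cfg n V) {x y : V} (hxy : S.h x = S.h y) : S.H.Reachable x y :=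
  (S.hr x).symm.trans (hxy ▸ S.hr y)

theorem Cfg.pu (S : Cfg n V) (i : ZMod n) : S.p (S.u i) = S.u 0 := by
  rw [S.hp, S.hu]; simp

theorem Cfg.u_inj (S : Cfg n V) {i j : ZMod n} (h : S.u i = S.u j) : i = j := by
  rw [← S.hu i, h, S.hu]

theorem Cfg.cyc_wk (S : Cfg n V) (K : SimpleGraph V)
    (hK : ∀ i, K.Adj (S.u i) (S.u (i + 1))) (i j : ZMod n) :
    Wk K (S.u i) (S.u j) (cd n i j) := by
  refine (cd_wk S.hn i j).map S.u ?_
  intro a b h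
  simp only [Cyc, SimpleGraph.fromRel_adj] at h
  rcases h.2 with h | h
  · rw [h]; exact hK a
  · rw [h]; exact (hK b).symm

/-- distance to the root -/
noncomputable def Cfg.l (S : Cfg n V) (x : V) : ℕ := S.H.dist (S.u (S.h x)) x

theorem Cfg.l_u (S : Cfg n V) (i : ZMod n) : S.l (S.u i) = 0 := by
  simp [Cfg.l, S.hu]

theorem Cfg.l_lip (S : Cfg n V) {a b : V} (h : S.H.Adj a b) : S.l b ≤ S.l a + 1 := by
  unfold Cfg.l
  rw [S.hadj a b h]
  exact dist_lip _ _ _ _ h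

theorem Cfg.l_wk (S : Cfg n V) (x : V) : Wk S.H (S.u (S.h x)) x (S.l x) :=
  Wk.of_reach (S.hr x)

/-- distances in the graph obtained by gluing all branches -/
noncomputable def Cfg.B (S : Cfg n V) (x y : V) : ℕ :=
  if S.h x = S.h y then S.H.dist x y else S.l x + S.l y

theorem Cfg.B_lip (S : Cfg n V) (x : V) {a b : V} (h : S.H.Adj a b) :
    S.B x b ≤ S.B x a + 1 := by
  unfold Cfg.B
  rw [S.hadj a b h]
  split_ifs
  · exact dist_lip _ _ _ _ h
  · have := S.l_lip h
    omega

theorem Cfg.B_u (S : Cfg n V) (x : V) (i : ZMod n) : S.B x (S.u i) = S.l x := by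
  unfold Cfg.B
  rw [S.l_u, S.hu]
  split_ifs with h
  · rw [Cfg.l, ← h, SimpleGraph.dist_comm]
  · rfl

theorem Cfg.B_self (S : Cfg n V) (x : V) : S.B x x = 0 := by simp [Cfg.B]

theorem Cfg.distG (S : Cfg n V) (x y : V) :
    S.G.dist x y = S.B x y + cd n (S.h x) (S.h y) := by
  apply dist_eq (fun y => S.B x y + cd n (S.h x) (S.h y))
  · intro a b hab
    rcases (S.hG a b).1 hab with h | ⟨i, h⟩
    · have := S.B_lip x h
      simp only [S.hadj a b h]
      omega
    · have h1 := cd_succ S.hn (S.h x) i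
      have h2 := cd_pred S.hn (S.h x) i
      rcases Sym2.eq_iff.1 h with ⟨rfl, rfl⟩ | ⟨rfl, rfl⟩ <;>
      · simp only [S.hu, S.B_u]
        omega
  · simp [S.B_self, cd_self]
  · have hle : ∀ a b, S.H.Adj a b → S.G.Adj (id a) (id b) := fun a b h => (S.hG a b).2 (Or.inl h)
    by_cases hxy : S.h x = S.h y
    · have : S.B x y + cd n (S.h x) (S.h y) = S.H.dist x y := by
        simp [Cfg.B, hxy, cd_self]
      simp only [this]
      exact (Wk.of_reach (S.reach hxy)).map id hle
    · have : S.B x y + cd n (S.h x) (S.h y) = S.l x + cd n (S.h x) (S.h y) + S.l y := by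
        simp [Cfg.B, hxy]; ring
      simp only [this]
      have hc := S.cyc_wk S.G (fun i => (S.hG _ _).2 (Or.inr ⟨i, rfl⟩)) (S.h x) (S.h y)
      exact (((S.l_wk x).symm.map id hle).trans hc).trans ((S.l_wk y).map id hle)

theorem Cfg.not_root (S : Cfg n V) {a b : V} (h : S.H.Adj a b) :
    ¬ (a = S.u (S.h a) ∧ b = S.u (S.h b)) := by
  rintro ⟨h1, h2⟩
  rw [S.hadj a b h, ← h2] at h1
  exact h.ne h1

theorem Cfg.distG'_aux (S : Cfg n V) (x y : V)
    (hw : Wk S.G' (S.p x) y (if y = S.u (S.h y) then S.l x + cd n 0 (S.h y) else S.B x y)) :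
    S.G'.dist (S.p x) y = if y = S.u (S.h y) then S.l x + cd n 0 (S.h y) else S.B x y := by
  have hFp : ∀ z, (if S.p z = S.u (S.h (S.p z)) then S.l x + cd n 0 (S.h (S.p z))
      else S.B x (S.p z)) = S.B x z := by
    intro z
    by_cases hz : z = S.u (S.h z)
    · have : S.p z = S.u 0 := by rw [S.hp, if_pos hz]
      rw [this, S.hu, if_pos rfl, cd_self, hz, S.B_u]; rfl
    · have : S.p z = z := by rw [S.hp, if_neg hz]
      rw [this, if_neg hz]
  refine dist_eq (fun y => if y = S.u (S.h y) then S.l x + cd n 0 (S.h y) else S.B x y)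
    ?_ ?_ hw
  · intro a b hab
    rcases (S.hG' a b).1 hab with ⟨c, d, h, rfl, rfl⟩ | ⟨i, h⟩
    · simp only [hFp]
      exact S.B_lip x h
    · have h1 := cd_succ S.hn 0 i
      have h2 := cd_pred S.hn 0 i
      rcases Sym2.eq_iff.1 h with ⟨rfl, rfl⟩ | ⟨rfl, rfl⟩ <;>
      · simp only [S.hu, if_true]
        omega
  · simp only [hFp, S.B_self]

theorem Cfg.wkp (S : Cfg n V) {x y : V} {a : ℕ} (h : Wk S.H x y a) :
    Wk S.G' (S.p x) (S.p y) a :=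
  h.map S.p (fun c d h => (S.hG' _ _).2 (Or.inl ⟨c, d, h, rfl, rfl⟩))

theorem Cfg.cycG' (S : Cfg n V) (i j : ZMod n) : Wk S.G' (S.u i) (S.u j) (cd n i j) :=
  S.cyc_wk S.G' (fun i => (S.hG' _ _).2 (Or.inr ⟨i, rfl⟩)) i j

theorem Cfg.distG'u (S : Cfg n V) (x : V) (j : ZMod n) :
    S.G'.dist (S.p x) (S.u j) = S.l x + cd n 0 j := by
  rw [S.distG'_aux]
  · simp [S.hu]
  · simp only [S.hu, if_true]
    have := S.wkp (S.l_wk x).symm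
    rw [S.pu] at this
    exact this.trans (S.cycG' 0 j)

theorem Cfg.distG'p (S : Cfg n V) (x y : V) :
    S.G'.dist (S.p x) (S.p y) = S.B x y := by
  by_cases hy : y = S.u (S.h y)
  · have : S.p y = S.u 0 := by rw [S.hp, if_pos hy]
    rw [this, S.distG'u, cd_self, hy, S.B_u]; rfl
  · have hpy : S.p y = y := by rw [S.hp, if_neg hy]
    have := S.distG'_aux x y
    rw [if_neg hy] at this
    rw [hpy]
    apply this
    rw [Cfg.B]
    split_ifs with hxy
    · have := S.wkp (Wk.of_reach (S.reach hxy))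
      rwa [hpy] at this
    · have h1 := S.wkp (S.l_wk x).symm
      have h2 := S.wkp (S.l_wk y)
      rw [S.pu] at h1 h2
      rw [hpy] at h2
      exact h1.trans h2

theorem Cfg.distG'c (S : Cfg n V) (i j : ZMod n) :
    S.G'.dist (S.u i) (S.u j) = cd n i j := by
  have key := dist_eq (K := S.G') (fun y => cd n i (if y = S.u (S.h y) then S.h y else 0))
    (x := S.u i) (y := S.u j) ?_ ?_ ?_
  · rw [key]; simp [S.hu]
  · have hz : ∀ z, (if S.p z = S.u (S.h (S.p z)) then S.h (S.p z) else 0) = 0 := by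
      intro z
      by_cases hz : z = S.u (S.h z)
      · have : S.p z = S.u 0 := by rw [S.hp, if_pos hz]
        rw [this]; simp [S.hu]
      · have : S.p z = z := by rw [S.hp, if_neg hz]
        rw [this, if_neg hz]
    intro a b hab
    rcases (S.hG' a b).1 hab with ⟨c, d, h, rfl, rfl⟩ | ⟨t, h⟩
    · simp only [hz]; omega
    · have h1 := cd_succ S.hn i t
      have h2 := cd_pred S.hn i t
      rcases Sym2.eq_iff.1 h with ⟨rfl, rfl⟩ | ⟨rfl, rfl⟩ <;>
      · simp only [S.hu, if_true]
        omega
  · simp [S.hu, cd_self]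
  · simp only [S.hu, if_true]
    exact S.cycG' i j

theorem Cfg.distGc (S : Cfg n V) (i j : ZMod n) :
    S.G.dist (S.u i) (S.u j) = cd n i j := by
  rw [S.distG, S.B_u, S.l_u, S.hu, S.hu]; simp

theorem Cfg.distGu (S : Cfg n V) (x : V) (j : ZMod n) :
    S.G.dist x (S.u (j + S.h x)) = S.G'.dist (S.p x) (S.u j) := by
  rw [S.distG, S.B_u, S.distG'u, S.hu]
  congr 1
  have := cd_add S.hn 0 j (S.h x)
  rwa [zero_add] at this

theorem Cfg.distGp (S : Cfg n V) (x y : V) :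
    S.G.dist x y = S.G'.dist (S.p x) (S.p y) + cd n (S.h x) (S.h y) := by
  rw [S.distG, S.distG'p]

theorem eDist_mk (K : SimpleGraph V) (a b c d : V) (h : s(a, b) ≠ s(c, d)) :
    eDist K s(a, b) s(c, d) =
      min (min (K.dist a c) (K.dist a d)) (min (K.dist b c) (K.dist b d)) + 1 := by
  rw [eDist, if_neg h]
  congr 1
  apply le_antisymm
  · refine le_min (le_min ?_ ?_) (le_min ?_ ?_) <;> apply Nat.sInf_le <;> simp
  · have hne : {n : ℕ | ∃ u ∈ s(a, b), ∃ w ∈ s(c, d), K.dist u w = n}.Nonempty :=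
      ⟨K.dist a c, a, by simp, c, by simp, rfl⟩
    obtain ⟨x, hx, y, hy, hxy⟩ := Nat.sInf_mem hne
    rw [← hxy]
    rcases Sym2.mem_iff.1 hx with rfl | rfl <;> rcases Sym2.mem_iff.1 hy with rfl | rfl <;> simp

theorem eDist_comm (K : SimpleGraph V) (e f : Sym2 V) : eDist K e f = eDist K f e := by
  unfold eDist
  by_cases h : e = f
  · simp [h]
  · rw [if_neg h, if_neg (Ne.symm h)]
    congr 2
    ext m
    constructor
    · rintro ⟨x, hx, y, hy, rfl⟩
      exact ⟨y, hy, x, hx, SimpleGraph.dist_comm⟩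
    · rintro ⟨x, hx, y, hy, rfl⟩
      exact ⟨y, hy, x, hx, SimpleGraph.dist_comm⟩

/-- cycle edge -/
def Cfg.Ce (S : Cfg n V) (i : ZMod n) : Sym2 V := s(S.u i, S.u (i + 1))

theorem Cfg.Ce_inj (S : Cfg n V) : Function.Injective S.Ce := by
  intro i j hij
  rcases Sym2.eq_iff.1 hij with ⟨h1, _⟩ | ⟨h1, h2⟩
  · exact S.u_inj h1
  · have h1 := S.u_inj h1
    have h2 := S.u_inj h2
    exfalso
    have h3 : ((2 : ℕ) : ZMod n) = 0 := by
      have : j + 1 + 1 = j := by rw [← h1, h2]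
      have h4 : j + (1 + 1) = j + 0 := by rw [← add_assoc, this, add_zero]
      have := add_left_cancel h4
      rw [← this]; push_cast; norm_num
    rw [ZMod.natCast_eq_zero_iff] at h3
    have := Nat.le_of_dvd (by norm_num) h3
    have := S.hn
    omega

/-- branch index of an edge -/
noncomputable def Cfg.hE (S : Cfg n V) (e : Sym2 V) : ZMod n := S.h e.out.1

theorem Cfg.hE_mk (S : Cfg n V) {a b : V} (h : S.H.Adj a b) : S.hE s(a, b) = S.h a := by
  have h1 : (s(a, b) : Sym2 V).out.1 ∈ s(a, b) := Sym2.out_fst_mem _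
  unfold Cfg.hE
  rcases Sym2.mem_iff.1 h1 with h2 | h2
  · rw [h2]
  · rw [h2, S.hadj a b h]

theorem Cfg.p_inj (S : Cfg n V) {a b c d : V} (h1 : S.H.Adj a b) (h2 : S.H.Adj c d)
    (hac : S.p a = S.p c) (hbd : S.p b = S.p d) : a = c ∧ b = d := by
  have k1 := S.not_root h1
  have k2 := S.not_root h2
  have e1 := S.hadj _ _ h1
  have e2 := S.hadj _ _ h2
  have z := S.hu 0
  have key : ∀ x y, S.p x = S.p y → (x = S.u (S.h x) ∧ y = S.u (S.h y)) ∨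
      (¬ x = S.u (S.h x) ∧ ¬ y = S.u (S.h y) ∧ x = y) := by
    intro x y hxy
    rw [S.hp, S.hp] at hxy
    split_ifs at hxy with hx hy hy
    · exact Or.inl ⟨hx, hy⟩
    · exfalso; apply hy; rw [← hxy, z]
    · exfalso; apply hx; rw [hxy, z]
    · exact Or.inr ⟨hx, hy, hxy⟩
  rcases key _ _ hac with ⟨ha, hc⟩ | ⟨ha, hc, hac⟩ <;>
    rcases key _ _ hbd with ⟨hb, hd⟩ | ⟨hb, hd, hbd⟩
  · exact absurd ⟨ha, hb⟩ k1
  · subst hbd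
    exact ⟨by rw [ha, hc, e1, e2], rfl⟩
  · subst hac
    exact ⟨rfl, by rw [hb, hd, ← e1, ← e2]⟩
  · exact ⟨hac, hbd⟩

theorem Cfg.map_inj (S : Cfg n V) {e f : Sym2 V} (he : e ∈ S.H.edgeSet) (hf : f ∈ S.H.edgeSet)
    (h : e.map S.p = f.map S.p) : e = f := by
  induction e with | _ a b
  induction f with | _ c d
  rw [SimpleGraph.mem_edgeSet] at he hf
  rw [Sym2.map_mk, Sym2.map_mk] at h
  rcases Sym2.eq_iff.1 h with ⟨h1, h2⟩ | ⟨h1, h2⟩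
  · obtain ⟨rfl, rfl⟩ := S.p_inj he hf h1 h2
    rfl
  · obtain ⟨rfl, rfl⟩ := S.p_inj he hf.symm h1 h2
    exact Sym2.eq_swap

theorem Cfg.map_ne (S : Cfg n V) {e : Sym2 V} (he : e ∈ S.H.edgeSet) (i : ZMod n) :
    e.map S.p ≠ S.Ce i := by
  induction e with | _ a b
  rw [SimpleGraph.mem_edgeSet] at he
  intro h
  have key : ∀ x y, S.p x = S.u y → x = S.u (S.h x) := by
    intro x y hxy
    rw [S.hp] at hxy
    split_ifs at hxy with hx
    · exact hx
    · rw [hxy, S.hu]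
  rw [Sym2.map_mk] at h
  rcases Sym2.eq_iff.1 h with ⟨h1, h2⟩ | ⟨h1, h2⟩
  · exact S.not_root he ⟨key _ _ h1, key _ _ h2⟩
  · exact S.not_root he ⟨key _ _ h1, key _ _ h2⟩

theorem Cfg.ne_Ce (S : Cfg n V) {e : Sym2 V} (he : e ∈ S.H.edgeSet) (i : ZMod n) :
    e ≠ S.Ce i := by
  induction e with | _ a b
  exact S.hdis a b he i

theorem Cfg.eDist_cc (S : Cfg n V) (i j : ZMod n) :
    eDist S.G' (S.Ce i) (S.Ce j) = eDist S.G (S.Ce i) (S.Ce j) := by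
  by_cases h : S.Ce i = S.Ce j
  · simp [eDist, h]
  · unfold Cfg.Ce at h ⊢
    rw [eDist_mk _ _ _ _ _ h, eDist_mk _ _ _ _ _ h]
    simp only [S.distG'c, S.distGc]

theorem Cfg.eDist_ec (S : Cfg n V) {e : Sym2 V} (he : e ∈ S.H.edgeSet) (j : ZMod n) :
    eDist S.G' (e.map S.p) (S.Ce j) = eDist S.G e (S.Ce (j + S.hE e)) := by
  have h1 := S.map_ne he j
  have h2 := S.ne_Ce he (j + S.hE e)
  induction e with | _ a b
  rw [SimpleGraph.mem_edgeSet] at he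
  rw [S.hE_mk he] at h2 ⊢
  rw [Sym2.map_mk] at h1 ⊢
  unfold Cfg.Ce at h1 h2 ⊢
  rw [eDist_mk _ _ _ _ _ h1, eDist_mk _ _ _ _ _ h2]
  rw [← S.distGu, ← S.distGu, ← S.distGu, ← S.distGu, S.hadj a b he, add_right_comm]

theorem Cfg.eDist_ef (S : Cfg n V) {e f : Sym2 V} (he : e ∈ S.H.edgeSet) (hf : f ∈ S.H.edgeSet) :
    eDist S.G e f = eDist S.G' (e.map S.p) (f.map S.p) + cd n (S.hE e) (S.hE f) := by
  by_cases hef : e = f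
  · subst hef
    simp [eDist, cd_self]
  · have h' : e.map S.p ≠ f.map S.p := fun h => hef (S.map_inj he hf h)
    induction e with | _ a b
    induction f with | _ c d
    rw [SimpleGraph.mem_edgeSet] at he hf
    rw [Sym2.map_mk, Sym2.map_mk] at h' ⊢
    rw [eDist_mk _ _ _ _ _ hef, eDist_mk _ _ _ _ _ h', S.hE_mk he, S.hE_mk hf]
    simp only [S.distGp, ← S.hadj a b he, ← S.hadj c d hf]
    omega

theorem Cfg.sumG [Fintype V] [NeZero n] (S : Cfg n V) (F : Sym2 V → ℕ) :
    ∑ e ∈ S.G.edgeFinset, F e = ∑ i, F (S.Ce i) + ∑ e ∈ S.H.edgeFinset, F e := by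
  have h : S.G.edgeFinset = univ.image S.Ce ∪ S.H.edgeFinset := by
    ext e
    induction e with | _ a b
    simp only [SimpleGraph.mem_edgeFinset, SimpleGraph.mem_edgeSet, mem_union, mem_image,
      mem_univ, true_and, S.hG, Cfg.Ce]
    rw [or_comm]
    simp only [eq_comm]
  rw [h, sum_union, sum_image (fun i _ j _ h => S.Ce_inj h)]
  rw [Finset.disjoint_left]
  intro e he hH
  obtain ⟨i, -, rfl⟩ := mem_image.1 he
  exact S.ne_Ce (SimpleGraph.mem_edgeFinset.1 hH) i rfl

theorem Cfg.sumG' [Fintype V] [NeZero n] (S : Cfg n V) (F : Sym2 V → ℕ) :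
    ∑ e ∈ S.G'.edgeFinset, F e = ∑ i, F (S.Ce i) + ∑ e ∈ S.H.edgeFinset, F (e.map S.p) := by
  have h : S.G'.edgeFinset = univ.image S.Ce ∪ S.H.edgeFinset.image (Sym2.map S.p) := by
    ext e
    induction e with | _ a b
    simp only [SimpleGraph.mem_edgeFinset, SimpleGraph.mem_edgeSet, mem_union, mem_image,
      mem_univ, true_and, S.hG', Cfg.Ce]
    rw [or_comm]
    apply or_congr
    · simp only [eq_comm]
    · constructor
      · rintro ⟨x, y, h, rfl, rfl⟩
        exact ⟨s(x, y), h, rfl⟩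
      · rintro ⟨e, he, h⟩
        induction e with | _ x y
        rw [Sym2.map_mk] at h
        rw [SimpleGraph.mem_edgeSet] at he
        rcases Sym2.eq_iff.1 h with ⟨h1, h2⟩ | ⟨h1, h2⟩
        · exact ⟨x, y, he, h1.symm, h2.symm⟩
        · exact ⟨y, x, he.symm, h2.symm, h1.symm⟩
  rw [h, sum_union, sum_image (fun i _ j _ h => S.Ce_inj h), sum_image]
  · intro e he f hf h
    exact S.map_inj (SimpleGraph.mem_edgeFinset.1 he) (SimpleGraph.mem_edgeFinset.1 hf) h
  rw [Finset.disjoint_left]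
  intro e he hH
  obtain ⟨i, -, rfl⟩ := mem_image.1 he
  obtain ⟨f, hf, h⟩ := mem_image.1 hH
  exact S.map_ne (SimpleGraph.mem_edgeFinset.1 hf) i h

theorem Cfg.main [Fintype V] (S : Cfg n V) :
    ∑ e ∈ S.G.edgeFinset, ∑ f ∈ S.G.edgeFinset, eDist S.G e f =
    ∑ e ∈ S.G'.edgeFinset, ∑ f ∈ S.G'.edgeFinset, eDist S.G' e f +
    ∑ e ∈ S.H.edgeFinset, ∑ f ∈ S.H.edgeFinset, cd n (S.hE e) (S.hE f) := by
  have : NeZero n := ⟨by have := S.hn; omega⟩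
  have hec : ∀ e ∈ S.H.edgeFinset, ∑ i, eDist S.G' (e.map S.p) (S.Ce i) =
      ∑ i, eDist S.G e (S.Ce i) := by
    intro e he
    rw [← Equiv.sum_comp (Equiv.addRight (S.hE e)) (fun i => eDist S.G e (S.Ce i))]
    exact sum_congr rfl fun i _ => S.eDist_ec (SimpleGraph.mem_edgeFinset.1 he) i
  have hef : ∑ e ∈ S.H.edgeFinset, ∑ f ∈ S.H.edgeFinset, eDist S.G e f =
      ∑ e ∈ S.H.edgeFinset, ∑ f ∈ S.H.edgeFinset, eDist S.G' (e.map S.p) (f.map S.p) +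
      ∑ e ∈ S.H.edgeFinset, ∑ f ∈ S.H.edgeFinset, cd n (S.hE e) (S.hE f) := by
    rw [← sum_add_distrib]
    refine sum_congr rfl fun e he => ?_
    rw [← sum_add_distrib]
    exact sum_congr rfl fun f hf => S.eDist_ef (SimpleGraph.mem_edgeFinset.1 he)
      (SimpleGraph.mem_edgeFinset.1 hf)
  have h1 := sum_congr (rfl : S.H.edgeFinset = _) hec
  have h2 : ∑ i, ∑ e ∈ S.H.edgeFinset, eDist S.G' (S.Ce i) (e.map S.p) =
      ∑ i, ∑ e ∈ S.H.edgeFinset, eDist S.G (S.Ce i) e := by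
    rw [sum_comm, sum_comm (s := univ)]
    simp only [eDist_comm _ (S.Ce _)]
    exact h1
  simp only [S.sumG, S.sumG', sum_add_distrib, hef, h1, h2, S.eDist_cc]
  ring

theorem Cfg.final [Fintype V] (S : Cfg n V) :
    edgeWiener S.G' ≤ edgeWiener S.G ∧ (edgeWiener S.G' = edgeWiener S.G ↔
      ∀ e ∈ S.H.edgeFinset, ∀ f ∈ S.H.edgeFinset, S.hE e = S.hE f) := by
  have hm := S.main
  unfold edgeWiener
  rw [hm]
  refine ⟨Nat.div_le_div_right (Nat.le_add_right _ _), ?_, ?_⟩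
  · intro h e he f hf
    by_contra hne
    have p1 := cd_pos S.hn hne
    have p2 := cd_pos S.hn (Ne.symm hne)
    have hef : e ≠ f := fun h => hne (h ▸ rfl)
    have h1 : ∑ e ∈ ({e, f} : Finset (Sym2 V)), ∑ f ∈ S.H.edgeFinset, cd n (S.hE e) (S.hE f) ≤
      ∑ e ∈ S.H.edgeFinset, ∑ f ∈ S.H.edgeFinset, cd n (S.hE e) (S.hE f) := by
      apply sum_le_sum_of_subset
      intro x hx
      rcases mem_insert.1 hx with rfl | hx
      · exact he
      · rw [mem_singleton.1 hx]; exact hf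
    rw [sum_pair hef] at h1
    have h2 := single_le_sum (f := fun g => cd n (S.hE e) (S.hE g)) (fun _ _ => Nat.zero_le _) hf
    have h3 := single_le_sum (f := fun g => cd n (S.hE f) (S.hE g)) (fun _ _ => Nat.zero_le _) he
    omega
  · intro h
    have : ∑ e ∈ S.H.edgeFinset, ∑ f ∈ S.H.edgeFinset, cd n (S.hE e) (S.hE f) = 0 := by
      refine sum_eq_zero fun e he => sum_eq_zero fun f hf => ?_
      rw [h e he f hf, cd_self]
    rw [this, add_zero]

end EW

theorem stmt3 {V : Type*} [Fintype V] (k : ℕ) (hk : 1 ≤ k)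
    (G : SimpleGraph V) (hconn : G.Connected)
    (v : ℕ → V)
    (hinj : ∀ i < 2 * k + 1, ∀ j < 2 * k + 1, v i = v j → i = j)
    (hcyc : ∀ i < 2 * k + 1, G.Adj (v i) (v ((i + 1) % (2 * k + 1))))
    (H : SimpleGraph V)
    (hH : H = G.deleteEdges {e | ∃ i < 2 * k + 1, e = s(v i, v ((i + 1) % (2 * k + 1)))})
    (hsep : ∀ i < 2 * k + 1, ∀ j < 2 * k + 1, i ≠ j → ¬ H.Reachable (v i) (v j))
    (m : ℕ → ℕ)
    (hm : ∀ i < 2 * k + 1,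
      m i = (H.edgeFinset.filter (fun f => ∀ x ∈ f, H.Reachable (v i) x)).card)
    (G' : SimpleGraph V)
    (hG' : G' = SimpleGraph.fromRel (fun a b =>
        (∃ i < 2 * k + 1, a = v i ∧ b = v ((i + 1) % (2 * k + 1))) ∨
        (H.Adj a b ∧ ∀ i, 1 ≤ i → i < 2 * k + 1 → a ≠ v i ∧ b ≠ v i) ∨
        (∃ i, 1 ≤ i ∧ i < 2 * k + 1 ∧ H.Adj a (v i) ∧ b = v 0))) :
    edgeWiener G' ≤ edgeWiener G ∧
      (edgeWiener G' = edgeWiener G ↔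
        ∀ i < 2 * k + 1, ∀ j < 2 * k + 1, i ≠ j → m i = 0 ∨ m j = 0) := by
  have hn3 : 3 ≤ 2 * k + 1 := by omega
  generalize 2 * k + 1 = n at *
  have : NeZero n := ⟨by omega⟩
  let u : ZMod n → V := fun a => v a.val
  have hvu : ∀ i < n, v i = u (i : ZMod n) := by
    intro i hi
    simp only [u]
    rw [ZMod.val_natCast_of_lt hi]
  have hvu' : ∀ i, v ((i + 1) % n) = u ((i : ZMod n) + 1) := by
    intro i
    simp only [u]
    rw [← ZMod.val_natCast, Nat.cast_succ]
  have hzn : ∀ a : ZMod n, ∃ i < n, (i : ZMod n) = a := fun a =>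
    ⟨a.val, a.val_lt, ZMod.natCast_zmod_val a⟩
  have hcycE : ∀ a b, (∃ i < n, s(a, b) = s(v i, v ((i + 1) % n))) ↔
      ∃ i, s(a, b) = s(u i, u (i + 1)) := by
    intro a b
    constructor
    · rintro ⟨i, hi, h⟩
      exact ⟨i, by rw [h, hvu i hi, hvu']⟩
    · rintro ⟨i, h⟩
      obtain ⟨i, hi, rfl⟩ := hzn i
      exact ⟨i, hi, by rw [h, hvu i hi, hvu']⟩
  have hsep' : ∀ i j, H.Reachable (u i) (u j) → i = j := by
    intro i j h
    obtain ⟨i, hi, rfl⟩ := hzn i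
    obtain ⟨j, hj, rfl⟩ := hzn j
    rw [← hvu i hi, ← hvu j hj] at h
    by_contra hne
    exact hsep i hi j hj (fun h' => hne (h' ▸ rfl)) h
  have hGc : ∀ i, G.Adj (u i) (u (i + 1)) := by
    intro i
    obtain ⟨i, hi, rfl⟩ := hzn i
    rw [← hvu i hi, ← hvu']
    exact hcyc i hi
  have hHadj : ∀ a b, H.Adj a b ↔ G.Adj a b ∧ ¬ ∃ i, s(a, b) = s(u i, u (i + 1)) := by
    intro a b
    rw [hH, SimpleGraph.deleteEdges_adj, ← hcycE]
    rfl
  have hGadj : ∀ a b, G.Adj a b ↔ H.Adj a b ∨ ∃ i, s(a, b) = s(u i, u (i + 1)) := by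
    intro a b
    rw [hHadj]
    constructor
    · intro h
      by_cases h' : ∃ i, s(a, b) = s(u i, u (i + 1))
      · exact Or.inr h'
      · exact Or.inl ⟨h, h'⟩
    · rintro (h | ⟨i, h⟩)
      · exact h.1
      · rw [← SimpleGraph.mem_edgeSet, h, SimpleGraph.mem_edgeSet]
        exact hGc i
  have hex : ∀ x, ∃ i, H.Reachable (u i) x := by
    intro x
    obtain ⟨w⟩ := hconn.preconnected x (u 0)
    have : ∀ x y (w : G.Walk x y), (∃ i, H.Reachable (u i) y) → ∃ i, H.Reachable (u i) x := by
      intro x y w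
      induction w with
      | nil => exact id
      | cons h w ih =>
        intro h0
        obtain ⟨i, hi⟩ := ih h0
        rcases (hGadj _ _).1 h with h | ⟨j, h⟩
        · exact ⟨i, hi.trans h.symm.reachable⟩
        · rcases Sym2.eq_iff.1 h with ⟨rfl, -⟩ | ⟨rfl, -⟩
          · exact ⟨_, SimpleGraph.Reachable.refl _⟩
          · exact ⟨_, SimpleGraph.Reachable.refl _⟩
    exact this x _ w ⟨0, SimpleGraph.Reachable.refl _⟩
  choose h hr using hex
  have hu : ∀ i, h (u i) = i := fun i => hsep' _ _ (hr (u i))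
  have hreach : ∀ x y, H.Reachable x y → h x = h y := fun x y hxy =>
    hsep' _ _ (((hr x).trans hxy).trans (hr y).symm)
  have hadj : ∀ a b, H.Adj a b → h a = h b := fun a b hab => hreach a b hab.reachable
  have hroot : ∀ a b, H.Adj a b → a = u (h a) → ¬ b = u (h b) := by
    intro a b hab h1 h2
    rw [hadj a b hab, ← h2] at h1
    exact hab.ne h1
  have hv0 : v 0 = u 0 := by simpa using hvu 0 (by omega)
  have hrootv : ∀ a, (∀ i, 1 ≤ i → i < n → a ≠ v i) ↔ (a = u (h a) → h a = 0) := by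
    intro a
    constructor
    · intro hi ha
      by_contra hne
      refine hi (h a).val ?_ (h a).val_lt ha
      exact Nat.one_le_iff_ne_zero.2 (fun h0 => hne ((ZMod.val_eq_zero _).1 h0))
    · intro hi i h1 h2 ha
      rw [hvu i h2] at ha
      have h3 : h a = (i : ZMod n) := by rw [ha, hu]
      have h4 := hi (by rw [h3, ha])
      rw [h3] at h4
      have h5 := congrArg ZMod.val h4
      rw [ZMod.val_natCast_of_lt h2, ZMod.val_zero] at h5
      omega
  let p : V → V := fun x => if x = u (h x) then u 0 else x
  have hp : ∀ x, p x = if x = u (h x) then u 0 else x := fun x => rfl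
  have hpid : ∀ x, (x = u (h x) → h x = 0) → p x = x := by
    intro x hx
    rw [hp]
    split_ifs with h1
    · rw [← hx h1]; exact h1.symm
    · rfl
  have hne1 : ∀ i, u i ≠ u (i + 1) := fun i => (hGc i).ne
  have hG'adj : ∀ a b, G'.Adj a b ↔ (∃ x y, H.Adj x y ∧ a = p x ∧ b = p y) ∨
      ∃ i, s(a, b) = s(u i, u (i + 1)) := by
    have hdir : ∀ a b, ((∃ i < n, a = v i ∧ b = v ((i + 1) % n)) ∨
        (H.Adj a b ∧ ∀ i, 1 ≤ i → i < n → a ≠ v i ∧ b ≠ v i) ∨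
        (∃ i, 1 ≤ i ∧ i < n ∧ H.Adj a (v i) ∧ b = v 0)) →
        (∃ x y, H.Adj x y ∧ a = p x ∧ b = p y) ∨ ∃ i, s(a, b) = s(u i, u (i + 1)) := by
      rintro a b (⟨i, hi, rfl, rfl⟩ | ⟨hab, hh⟩ | ⟨i, h1, h2, h3, rfl⟩)
      · exact Or.inr ((hcycE _ _).1 ⟨i, hi, rfl⟩)
      · left
        refine ⟨a, b, hab, (hpid a ?_).symm, (hpid b ?_).symm⟩
        · exact (hrootv a).1 fun i h1 h2 => (hh i h1 h2).1
        · exact (hrootv b).1 fun i h1 h2 => (hh i h1 h2).2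
      · left
        rw [hvu i h2] at h3
        refine ⟨a, _, h3, (hpid a ?_).symm, ?_⟩
        · intro ha
          exact absurd (by rw [hu]) (hroot _ _ h3 ha)
        · rw [hp, hu, if_pos rfl, hv0]
    intro a b
    rw [hG', SimpleGraph.fromRel_adj]
    constructor
    · rintro ⟨-, h1 | h1⟩
      · exact hdir a b h1
      · rcases hdir b a h1 with ⟨x, y, h2, h3, h4⟩ | ⟨i, h2⟩
        · exact Or.inl ⟨y, x, h2.symm, h4, h3⟩
        · exact Or.inr ⟨i, by rw [Sym2.eq_swap, h2]⟩
    · rintro (⟨x, y, hxy, rfl, rfl⟩ | h1)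
      · have hmain : ∀ x y, H.Adj x y → x = u (h x) → p x ≠ p y ∧ 
          (((H.Adj (p x) (p y) ∧ ∀ i, 1 ≤ i → i < n → p x ≠ v i ∧ p y ≠ v i)) ∨
            (∃ i, 1 ≤ i ∧ i < n ∧ H.Adj (p y) (v i) ∧ p x = v 0)) := by
          intro x y hxy hx
          have hy := hroot x y hxy hx
          have hpy : p y = y := hpid y (fun h => absurd h hy)
          have hpx : p x = u 0 := by rw [hp, if_pos hx]
          rw [hpy]
          refine ⟨?_, ?_⟩
          · intro h1
            apply hy
            rw [← h1, hpx, hu]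
          by_cases h0 : h x = 0
          · left
            have hpx' : p x = x := hpid x (fun _ => h0)
            rw [hpx']
            refine ⟨hxy, fun i h1 h2 => ⟨?_, ?_⟩⟩
            · exact (hrootv x).2 (fun _ => h0) i h1 h2
            · exact (hrootv y).2 (fun h => absurd h hy) i h1 h2
          · right
            refine ⟨(h x).val, ?_, (h x).val_lt, ?_, ?_⟩
            · exact Nat.one_le_iff_ne_zero.2 (fun h1 => h0 ((ZMod.val_eq_zero _).1 h1))
            · change H.Adj y (u (h x))
              rw [← hx]; exact hxy.symm
            · rw [hpx, hv0]
        by_cases hx : x = u (h x)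
        · obtain ⟨h1, h2 | h2⟩ := hmain x y hxy hx
          · exact ⟨h1, Or.inl (Or.inr (Or.inl h2))⟩
          · exact ⟨h1, Or.inr (Or.inr (Or.inr h2))⟩
        by_cases hy : y = u (h y)
        · obtain ⟨h1, h2 | h2⟩ := hmain y x hxy.symm hy
          · exact ⟨h1.symm, Or.inr (Or.inr (Or.inl h2))⟩
          · exact ⟨h1.symm, Or.inl (Or.inr (Or.inr h2))⟩
        rw [hpid x (fun h => absurd h hx), hpid y (fun h => absurd h hy)]
        refine ⟨hxy.ne, Or.inl (Or.inr (Or.inl ⟨hxy, fun i h1 h2 => ⟨?_, ?_⟩⟩))⟩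
        · exact (hrootv x).2 (fun h => absurd h hx) i h1 h2
        · exact (hrootv y).2 (fun h => absurd h hy) i h1 h2
      · have hab : a ≠ b := by
          obtain ⟨i, h1⟩ := h1
          rcases Sym2.eq_iff.1 h1 with ⟨rfl, rfl⟩ | ⟨rfl, rfl⟩
          · exact hne1 i
          · exact (hne1 i).symm
        obtain ⟨i, hi, h1⟩ := (hcycE a b).2 h1
        refine ⟨hab, ?_⟩
        rcases Sym2.eq_iff.1 h1 with ⟨h1, h2⟩ | ⟨h1, h2⟩
        · exact Or.inl (Or.inl ⟨i, hi, h1, h2⟩)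
        · exact Or.inr (Or.inl ⟨i, hi, h2, h1⟩)
  let S : EW.Cfg n V :=
    { hn := hn3, H := H, u := u, h := h, hr := hr, hu := hu, hadj := hadj, G := G, G' := G'
      p := p, hp := hp, hG := hGadj, hG' := hG'adj
      hdis := fun a b hab i hi => ((hHadj a b).1 hab).2 ⟨i, hi⟩ }
  obtain ⟨f1, f2⟩ := S.final
  refine ⟨f1, f2.trans ?_⟩
  have hmem : ∀ i < n, ∀ e ∈ H.edgeFinset, (∀ x ∈ e, H.Reachable (v i) x) ↔
      S.hE e = (i : ZMod n) := by
    intro i hi e he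
    rw [SimpleGraph.mem_edgeFinset] at he
    induction e with | _ a b
    rw [SimpleGraph.mem_edgeSet] at he
    rw [S.hE_mk he, hvu i hi]
    change _ ↔ h a = _
    constructor
    · intro h1
      rw [← hreach _ _ (h1 a (by simp)), hu]
    · intro h1 x hx
      rw [← h1]
      rcases Sym2.mem_iff.1 hx with rfl | rfl
      · exact hr x
      · rw [hadj _ _ he]; exact hr x
  have hm0 : ∀ i < n, m i = 0 ↔ ∀ e ∈ H.edgeFinset, S.hE e ≠ (i : ZMod n) := by
    intro i hi
    rw [hm i hi, Finset.card_eq_zero, Finset.filter_eq_empty_iff]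
    exact forall₂_congr fun e he => not_congr (hmem i hi e he)
  constructor
  · intro hall i hi j hj hij
    by_contra hcon
    rw [not_or, hm0 i hi, hm0 j hj] at hcon
    push Not at hcon
    obtain ⟨⟨e, he, he'⟩, f, hf, hf'⟩ := hcon
    have h1 := hall e he f hf
    rw [he', hf'] at h1
    have h2 := congrArg ZMod.val h1
    rw [ZMod.val_natCast_of_lt hi, ZMod.val_natCast_of_lt hj] at h2
    exact hij h2
  · intro hall e he f hf
    by_contra hne
    obtain ⟨i, hi, hi'⟩ := hzn (S.hE e)
    obtain ⟨j, hj, hj'⟩ := hzn (S.hE f)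
    have hij : i ≠ j := by
      rintro rfl
      exact hne (hi'.symm.trans hj')
    rcases hall i hi j hj hij with h0 | h0
    · exact (hm0 i hi).1 h0 e he hi'.symm
    · exact (hm0 j hj).1 h0 f hf hj'.symm
end

section
/- Let H1, …, H4 be pairwise disjoint connected simple graphs with xi ∈ V(Hi), |V(Hi)| ≥ 2 and mi = |E(Hi)| ≥ 1, such that m1 = max{m1, m2, m3, m4}. Let G be obtained from the 4-cycle C4 = v1v2v3v4v1 and H1, …, H4 by identifying xi with vi for i = 1, …, 4, and let G' = G − v1v4 + v2v4. Then W_e(G') − W_e(G) = (m1 − m2)·m4 + 2m1 − m2 − 1 ≥ 0, with equality if and only if m1 = m2 = m3 = m4 = 1. -/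
open SimpleGraph Finset
open scoped Classical

structure CycData (ε : Fin 4 → Fin 4 × Fin 4) (c : Fin 4 → Fin 4 → ℕ) : Prop where
  c0 : ∀ i, c i i = 0
  c0' : ∀ i j, c i j = 0 → i = j
  symm : ∀ i j, c i j = c j i
  lip : ∀ i t, c i (ε t).1 ≤ c i (ε t).2 + 1 ∧ c i (ε t).2 ≤ c i (ε t).1 + 1
  pred : ∀ i j, c i j ≠ 0 → ∃ t, ((ε t).2 = j ∧ c i (ε t).1 + 1 = c i j) ∨
    ((ε t).1 = j ∧ c i (ε t).2 + 1 = c i j)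
  ne : ∀ t, (ε t).1 ≠ (ε t).2
  inj : ∀ t t', s((ε t).1, (ε t).2) = s((ε t').1, (ε t').2) → t = t'

structure Comp {V : Type*} (H : SimpleGraph V) (u : Fin 4 → V) (p : V → Fin 4) : Prop where
  adj : ∀ x y, H.Adj x y → p x = p y
  reach : ∀ x, H.Reachable (u (p x)) x
  pu : ∀ i, p (u i) = i

def IsGlue {V : Type*} (H : SimpleGraph V) (u : Fin 4 → V) (ε : Fin 4 → Fin 4 × Fin 4)
    (K : SimpleGraph V) : Prop :=
  ∀ x y, K.Adj x y ↔ H.Adj x y ∨ ∃ t, s(x, y) = s(u (ε t).1, u (ε t).2)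

noncomputable def DD {V : Type*} (H : SimpleGraph V) (u : Fin 4 → V) (p : V → Fin 4)
    (c : Fin 4 → Fin 4 → ℕ) (x y : V) : ℕ :=
  if p x = p y then H.dist x y else H.dist (u (p x)) x + c (p x) (p y) + H.dist (u (p y)) y

section
variable {V : Type*} {H K : SimpleGraph V} {u : Fin 4 → V} {p : V → Fin 4}
  {ε : Fin 4 → Fin 4 × Fin 4} {c : Fin 4 → Fin 4 → ℕ}

lemma DD_u (hc : CycData ε c) (hp : Comp H u p) (x : V) (i : Fin 4) :
    DD H u p c x (u i) = H.dist (u (p x)) x + c (p x) i := by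
  unfold DD
  rw [hp.pu]
  split_ifs with h
  · subst h; rw [hc.c0, SimpleGraph.dist_comm]; simp
  · simp

lemma DD_lip (hc : CycData ε c) (hp : Comp H u p) (hK : IsGlue H u ε K) (x y z : V)
    (h : K.Adj y z) : DD H u p c x z ≤ DD H u p c x y + 1 := by
  rcases (hK y z).1 h with h | ⟨t, ht⟩
  · have e := hp.adj _ _ h
    have h1 : H.dist y z = 1 := SimpleGraph.dist_eq_one_iff_adj.2 h
    unfold DD
    rw [← e]
    split_ifs with h2
    · have hr : H.Reachable x y := by
        have a := hp.reach x
        rw [h2] at a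
        exact a.symm.trans (hp.reach y)
      have : H.dist x z ≤ H.dist x y + H.dist y z := by
        obtain ⟨w1, hw1⟩ := hr.exists_walk_length_eq_dist
        obtain ⟨w2, hw2⟩ := h.reachable.exists_walk_length_eq_dist
        rw [← hw1, ← hw2, ← SimpleGraph.Walk.length_append]
        exact SimpleGraph.dist_le _
      omega
    · have : H.dist (u (p y)) z ≤ H.dist (u (p y)) y + H.dist y z := by
        obtain ⟨w1, hw1⟩ := (hp.reach y).exists_walk_length_eq_dist
        obtain ⟨w2, hw2⟩ := h.reachable.exists_walk_length_eq_dist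
        rw [← hw1, ← hw2, ← SimpleGraph.Walk.length_append]
        exact SimpleGraph.dist_le _
      omega
  · have := hc.lip (p x) t
    rcases Sym2.eq_iff.1 ht with ⟨rfl, rfl⟩ | ⟨rfl, rfl⟩
    all_goals rw [DD_u hc hp, DD_u hc hp]; omega

lemma DD_le_walk (hc : CycData ε c) (hp : Comp H u p) (hK : IsGlue H u ε K) (x : V) {y z : V}
    (w : K.Walk y z) : DD H u p c x z ≤ DD H u p c x y + w.length := by
  induction w with
  | nil => simp
  | cons h w ih =>
    have := DD_lip hc hp hK x _ _ h
    simp only [SimpleGraph.Walk.length_cons]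
    omega

lemma glue_walk (hc : CycData ε c) (hK : IsGlue H u ε K) (n : ℕ) : ∀ i j, c i j = n →
    ∃ w : K.Walk (u i) (u j), w.length = n := by
  induction n with
  | zero =>
    intro i j h
    obtain rfl := hc.c0' _ _ h
    exact ⟨SimpleGraph.Walk.nil, rfl⟩
  | succ n ih =>
    intro i j h
    obtain ⟨t, ⟨h1, h2⟩ | ⟨h1, h2⟩⟩ := hc.pred i j (by omega)
    · obtain ⟨w, hw⟩ := ih i (ε t).1 (by omega)
      have ha : K.Adj (u (ε t).1) (u j) := (hK _ _).2 (Or.inr ⟨t, by rw [h1]⟩)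
      exact ⟨w.concat ha, by simp [hw]⟩
    · obtain ⟨w, hw⟩ := ih i (ε t).2 (by omega)
      have ha : K.Adj (u (ε t).2) (u j) := (hK _ _).2 (Or.inr ⟨t, by rw [h1, Sym2.eq_swap]⟩)
      exact ⟨w.concat ha, by simp [hw]⟩

lemma H_le_K (hK : IsGlue H u ε K) : H ≤ K := fun x y h => (hK x y).2 (Or.inl h)

lemma H_walk (hK : IsGlue H u ε K) {x y : V} (h : H.Reachable x y) :
    ∃ w : K.Walk x y, w.length = H.dist x y := by
  obtain ⟨w, hw⟩ := h.exists_walk_length_eq_dist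
  exact ⟨w.mapLe (H_le_K hK), by simp [hw]⟩

lemma dist_eq (hc : CycData ε c) (hp : Comp H u p) (hK : IsGlue H u ε K) (x y : V) :
    K.dist x y = DD H u p c x y := by
  have key : ∃ w : K.Walk x y, w.length = DD H u p c x y := by
    unfold DD
    split_ifs with h
    · apply H_walk hK
      have a := hp.reach x
      rw [h] at a
      exact a.symm.trans (hp.reach y)
    · obtain ⟨w1, h1⟩ := H_walk hK (hp.reach x)
      obtain ⟨w2, h2⟩ := glue_walk hc hK _ (p x) (p y) rfl
      obtain ⟨w3, h3⟩ := H_walk hK (hp.reach y)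
      exact ⟨(w1.reverse.append w2).append w3, by simp [h1, h2, h3]⟩
  obtain ⟨w, hw⟩ := key
  apply le_antisymm
  · rw [← hw]; exact SimpleGraph.dist_le w
  · obtain ⟨w', hw'⟩ := SimpleGraph.Reachable.exists_walk_length_eq_dist ⟨w⟩
    have := DD_le_walk hc hp hK x w'
    have h0 : DD H u p c x x = 0 := by simp [DD]
    omega

lemma sInf4 (a b c d : ℕ) (P : ℕ → Prop) (h : ∀ n, P n ↔ (n = a ∨ n = b ∨ n = c ∨ n = d)) :
    sInf {n : ℕ | P n} = min (min a b) (min c d) := by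
  apply le_antisymm
  · apply Nat.sInf_le
    rw [Set.mem_ofPred_eq, h]; omega
  · have hne : {n : ℕ | P n}.Nonempty := ⟨a, (h a).2 (Or.inl rfl)⟩
    have := Nat.sInf_mem hne
    rw [Set.mem_ofPred_eq, h] at this
    omega

lemma eDist_mk (K : SimpleGraph V) (a b x y : V) (h : s(a, b) ≠ s(x, y)) :
    eDist K s(a, b) s(x, y) =
      min (min (K.dist a x) (K.dist a y)) (min (K.dist b x) (K.dist b y)) + 1 := by
  unfold eDist
  rw [if_neg h, sInf4 (K.dist a x) (K.dist a y) (K.dist b x) (K.dist b y)]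
  intro n
  simp only [Sym2.mem_iff]
  constructor
  · rintro ⟨_, rfl | rfl, _, rfl | rfl, rfl⟩ <;> simp
  · rintro (rfl | rfl | rfl | rfl)
    · exact ⟨a, by simp, x, by simp, rfl⟩
    · exact ⟨a, by simp, y, by simp, rfl⟩
    · exact ⟨b, by simp, x, by simp, rfl⟩
    · exact ⟨b, by simp, y, by simp, rfl⟩

lemma vDist_mk (K : SimpleGraph V) (a x y : V) :
    vDist K a s(x, y) = min (K.dist a x) (K.dist a y) := by
  unfold vDist
  rw [sInf4 (K.dist a x) (K.dist a y) (K.dist a x) (K.dist a y)]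
  · simp
  intro n
  simp only [Sym2.mem_iff]
  constructor
  · rintro ⟨_, rfl | rfl, rfl⟩ <;> simp
  · rintro (rfl | rfl | rfl | rfl)
    · exact ⟨x, by simp, rfl⟩
    · exact ⟨y, by simp, rfl⟩
    · exact ⟨x, by simp, rfl⟩
    · exact ⟨y, by simp, rfl⟩

lemma eDist_comm (K : SimpleGraph V) (e f : Sym2 V) : eDist K e f = eDist K f e := by
  by_cases h : e = f
  · rw [h]
  induction e with | _ a b =>
  induction f with | _ x y =>
  rw [eDist_mk _ _ _ _ _ h, eDist_mk _ _ _ _ _ (Ne.symm h)]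
  rw [K.dist_comm (u := a) (v := x), K.dist_comm (u := a) (v := y),
    K.dist_comm (u := b) (v := x), K.dist_comm (u := b) (v := y)]
  omega

noncomputable def qq (p : V → Fin 4) (e : Sym2 V) : Fin 4 := p (Quot.out e).1

lemma qq_mk (hp : Comp H u p) (a b : V) (h : H.Adj a b) : qq p s(a, b) = p a := by
  unfold qq
  have : (Quot.out s(a, b)).1 ∈ s(a, b) := Sym2.out_fst_mem _
  rcases Sym2.mem_iff.1 this with h1 | h1
  · rw [h1]
  · rw [h1, hp.adj _ _ h]

noncomputable def baseD (H : SimpleGraph V) (u : Fin 4 → V) (p : V → Fin 4) (e f : Sym2 V) : ℕ :=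
  if qq p e = qq p f then eDist H e f
  else vDist H (u (qq p e)) e + vDist H (u (qq p f)) f + 1

lemma eDist_HH (hc : CycData ε c) (hp : Comp H u p) (hK : IsGlue H u ε K) (e f : Sym2 V)
    (he : e ∈ H.edgeSet) (hf : f ∈ H.edgeSet) :
    eDist K e f = baseD H u p e f + c (qq p e) (qq p f) := by
  by_cases h : e = f
  · subst h; simp [baseD, eDist, hc.c0]
  induction e with | _ a b =>
  induction f with | _ x y =>
  rw [SimpleGraph.mem_edgeSet] at he hf
  have e1 := hp.adj _ _ he
  have e2 := hp.adj _ _ hf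
  rw [eDist_mk _ _ _ _ _ h, baseD, qq_mk hp _ _ he, qq_mk hp _ _ hf, vDist_mk, vDist_mk,
    eDist_mk _ _ _ _ _ h]
  simp only [dist_eq hc hp hK, DD, ← e1, ← e2]
  split_ifs with h3
  · rw [h3, hc.c0]
  · omega

def cyE (u : Fin 4 → V) (ε : Fin 4 → Fin 4 × Fin 4) (t : Fin 4) : Sym2 V :=
  s(u (ε t).1, u (ε t).2)

lemma cyE_not (hc : CycData ε c) (hp : Comp H u p) (t : Fin 4) : cyE u ε t ∉ H.edgeSet := by
  intro h
  have := hp.adj _ _ ((SimpleGraph.mem_edgeSet _).1 h)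
  rw [hp.pu, hp.pu] at this
  exact hc.ne t this

lemma cyE_inj (hc : CycData ε c) (hp : Comp H u p) : Function.Injective (cyE u ε) := by
  intro t t' h
  apply hc.inj
  have := congrArg (Sym2.map p) h
  simpa [cyE, hp.pu] using this

lemma eDist_HC (hc : CycData ε c) (hp : Comp H u p) (hK : IsGlue H u ε K) (e : Sym2 V)
    (t : Fin 4) (he : e ∈ H.edgeSet) :
    eDist K e (cyE u ε t) = vDist H (u (qq p e)) e + 1 +
      min (c (qq p e) (ε t).1) (c (qq p e) (ε t).2) := by
  have h : e ≠ cyE u ε t := by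
    rintro rfl; exact cyE_not hc hp t he
  induction e with | _ a b =>
  rw [SimpleGraph.mem_edgeSet] at he
  have e1 := hp.adj _ _ he
  unfold cyE at h ⊢
  rw [eDist_mk _ _ _ _ _ h, qq_mk hp _ _ he, vDist_mk]
  simp only [dist_eq hc hp hK, DD_u hc hp, ← e1]
  omega

lemma eDist_CC (hc : CycData ε c) (hp : Comp H u p) (hK : IsGlue H u ε K) (t t' : Fin 4) :
    eDist K (cyE u ε t) (cyE u ε t') = if t = t' then 0 else
      min (min (c (ε t).1 (ε t').1) (c (ε t).1 (ε t').2))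
        (min (c (ε t).2 (ε t').1) (c (ε t).2 (ε t').2)) + 1 := by
  split_ifs with h
  · subst h; simp [eDist]
  have h' : cyE u ε t ≠ cyE u ε t' := fun h' => h (cyE_inj hc hp h')
  unfold cyE at h' ⊢
  rw [eDist_mk _ _ _ _ _ h']
  simp only [dist_eq hc hp hK, DD_u hc hp, hp.pu]
  simp

lemma sum_q [Fintype V] (m : Fin 4 → ℕ)
    (hm : ∀ i, m i = (H.edgeFinset.filter (fun f => qq p f = i)).card) (g : Fin 4 → ℕ) :
    ∑ e ∈ H.edgeFinset, g (qq p e) = ∑ i, m i * g i := by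
  rw [← Finset.sum_fiberwise (s := H.edgeFinset) (g := qq p)]
  apply Finset.sum_congr rfl
  intro i _
  rw [hm, Finset.sum_congr rfl (g := fun _ => g i)]
  · simp
  · intro x hx
    rw [(Finset.mem_filter.1 hx).2]

lemma total [Fintype V] (hc : CycData ε c) (hp : Comp H u p) (hK : IsGlue H u ε K)
    (m : Fin 4 → ℕ) (hm : ∀ i, m i = (H.edgeFinset.filter (fun f => qq p f = i)).card) :
    ∑ e ∈ K.edgeFinset, ∑ f ∈ K.edgeFinset, eDist K e f =
      ∑ e ∈ H.edgeFinset, ∑ f ∈ H.edgeFinset, baseD H u p e f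
      + 2 * ∑ e ∈ H.edgeFinset, 4 * (vDist H (u (qq p e)) e + 1)
      + ∑ i, m i * ∑ j, m j * c i j
      + 2 * ∑ i, m i * ∑ t, min (c i (ε t).1) (c i (ε t).2)
      + ∑ t, ∑ t', if t = t' then 0 else
      min (min (c (ε t).1 (ε t').1) (c (ε t).1 (ε t').2))
        (min (c (ε t).2 (ε t').1) (c (ε t).2 (ε t').2)) + 1 := by
  have hE : K.edgeFinset = H.edgeFinset ∪ Finset.univ.image (cyE u ε) := by
    ext e
    induction e with | _ a b =>
    simp only [SimpleGraph.mem_edgeFinset, SimpleGraph.mem_edgeSet, Finset.mem_union,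
      Finset.mem_image, Finset.mem_univ, true_and]
    rw [hK a b]
    simp only [cyE, eq_comm]
  have hd : Disjoint H.edgeFinset (Finset.univ.image (cyE u ε)) := by
    rw [Finset.disjoint_left]
    intro e he h
    obtain ⟨t, _, rfl⟩ := Finset.mem_image.1 h
    exact cyE_not hc hp t (SimpleGraph.mem_edgeFinset.1 he)
  have hs : ∀ g : Sym2 V → ℕ, ∑ e ∈ K.edgeFinset, g e =
      ∑ e ∈ H.edgeFinset, g e + ∑ t, g (cyE u ε t) := by
    intro g
    rw [hE, Finset.sum_union hd, Finset.sum_image (fun a _ b _ h => cyE_inj hc hp h)]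
  have h1 : ∑ e ∈ H.edgeFinset, ∑ f ∈ H.edgeFinset, eDist K e f =
      ∑ e ∈ H.edgeFinset, ∑ f ∈ H.edgeFinset, baseD H u p e f
      + ∑ i, m i * ∑ j, m j * c i j := by
    rw [← sum_q m hm (fun i => ∑ j, m j * c i j), ← Finset.sum_add_distrib]
    apply Finset.sum_congr rfl
    intro e he
    rw [← sum_q m hm (fun j => c (qq p e) j), ← Finset.sum_add_distrib]
    apply Finset.sum_congr rfl
    intro f hf
    exact eDist_HH hc hp hK e f (SimpleGraph.mem_edgeFinset.1 he) (SimpleGraph.mem_edgeFinset.1 hf)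
  have h2 : ∑ e ∈ H.edgeFinset, ∑ t, eDist K e (cyE u ε t) =
      ∑ e ∈ H.edgeFinset, 4 * (vDist H (u (qq p e)) e + 1)
      + ∑ i, m i * ∑ t, min (c i (ε t).1) (c i (ε t).2) := by
    rw [← sum_q m hm (fun i => ∑ t, min (c i (ε t).1) (c i (ε t).2)), ← Finset.sum_add_distrib]
    apply Finset.sum_congr rfl
    intro e he
    rw [Finset.sum_congr rfl
      (fun t _ => eDist_HC hc hp hK e t (SimpleGraph.mem_edgeFinset.1 he)), Finset.sum_add_distrib]
    simp
  have h3 : ∑ t, ∑ f ∈ H.edgeFinset, eDist K (cyE u ε t) f =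
      ∑ e ∈ H.edgeFinset, ∑ t, eDist K e (cyE u ε t) := by
    rw [Finset.sum_comm]
    simp only [eDist_comm K (cyE u ε _) _]
  rw [hs]
  simp only [hs]
  rw [Finset.sum_add_distrib, Finset.sum_add_distrib, h3, h1, h2]
  simp only [eDist_CC hc hp hK]
  ring

end

def eps1 : Fin 4 → Fin 4 × Fin 4 := ![(0, 1), (1, 2), (2, 3), (3, 0)]
def eps2 : Fin 4 → Fin 4 × Fin 4 := ![(0, 1), (1, 2), (2, 3), (1, 3)]
def cc1 : Fin 4 → Fin 4 → ℕ := ![![0, 1, 2, 1], ![1, 0, 1, 2], ![2, 1, 0, 1], ![1, 2, 1, 0]]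
def cc2 : Fin 4 → Fin 4 → ℕ := ![![0, 1, 2, 2], ![1, 0, 1, 1], ![2, 1, 0, 1], ![2, 1, 1, 0]]

lemma data1 : CycData eps1 cc1 := by
  constructor <;> decide
lemma data2 : CycData eps2 cc2 := by
  constructor <;> decide

theorem stmt6 {V : Type*} [Fintype V]
    (G : SimpleGraph V) (hconn : G.Connected)
    (v : ℕ → V)
    (hinj : ∀ i < 4, ∀ j < 4, v i = v j → i = j)
    (hcyc : ∀ i < 4, G.Adj (v i) (v ((i + 1) % 4)))
    (H : SimpleGraph V)
    (hH : H = G.deleteEdges {e | ∃ i < 4, e = s(v i, v ((i + 1) % 4))})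
    (hsep : ∀ i < 4, ∀ j < 4, i ≠ j → ¬ H.Reachable (v i) (v j))
    (m : ℕ → ℕ)
    (hm : ∀ i < 4,
      m i = (H.edgeFinset.filter (fun f => ∀ x ∈ f, H.Reachable (v i) x)).card)
    (hm1 : ∀ i < 4, 1 ≤ m i) (hmax : ∀ i < 4, m i ≤ m 0)
    (G' : SimpleGraph V)
    (hG' : G' = SimpleGraph.fromRel (fun a b =>
        (G.Adj a b ∧ s(a, b) ≠ s(v 0, v 3)) ∨ (a = v 1 ∧ b = v 3))) :
    (edgeWiener G' : ℤ) - (edgeWiener G : ℤ)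
        = ((m 0 : ℤ) - m 1) * m 3 + 2 * m 0 - m 1 - 1 ∧
      edgeWiener G ≤ edgeWiener G' ∧
      (edgeWiener G = edgeWiener G' ↔ m 0 = 1 ∧ m 1 = 1 ∧ m 2 = 1 ∧ m 3 = 1) := by
  
  have hcy : ∀ a b, (∃ i < 4, s(a, b) = s(v i, v ((i + 1) % 4))) ↔
      (s(a, b) = s(v 0, v 1) ∨ s(a, b) = s(v 1, v 2) ∨ s(a, b) = s(v 2, v 3) ∨
        s(a, b) = s(v 3, v 0)) := by
    intro a b
    constructor
    · rintro ⟨i, hi, h⟩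
      interval_cases i <;> simp at h <;> simp [h]
    · rintro (h | h | h | h)
      exacts [⟨0, by norm_num, h⟩, ⟨1, by norm_num, h⟩, ⟨2, by norm_num, h⟩, ⟨3, by norm_num, h⟩]
  have hHadj : ∀ a b, H.Adj a b ↔ G.Adj a b ∧ ¬ (s(a, b) = s(v 0, v 1) ∨ s(a, b) = s(v 1, v 2) ∨
      s(a, b) = s(v 2, v 3) ∨ s(a, b) = s(v 3, v 0)) := by
    intro a b
    rw [hH, SimpleGraph.deleteEdges_adj, Set.mem_ofPred_eq, hcy]
  have g01 : G.Adj (v 0) (v 1) := hcyc 0 (by norm_num)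
  have g12 : G.Adj (v 1) (v 2) := hcyc 1 (by norm_num)
  have g23 : G.Adj (v 2) (v 3) := hcyc 2 (by norm_num)
  have g30 : G.Adj (v 3) (v 0) := hcyc 3 (by norm_num)
  have hG1 : ∀ a b, G.Adj a b ↔ H.Adj a b ∨ (s(a, b) = s(v 0, v 1) ∨ s(a, b) = s(v 1, v 2) ∨
      s(a, b) = s(v 2, v 3) ∨ s(a, b) = s(v 3, v 0)) := by
    intro a b
    rw [hHadj]
    have : (s(a, b) = s(v 0, v 1) ∨ s(a, b) = s(v 1, v 2) ∨
      s(a, b) = s(v 2, v 3) ∨ s(a, b) = s(v 3, v 0)) → G.Adj a b := by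
      rw [← SimpleGraph.mem_edgeSet]
      rintro (h | h | h | h) <;> rw [h] <;> assumption
    tauto
  obtain ⟨u, hu⟩ : ∃ u : Fin 4 → V, ∀ i, u i = v i := ⟨fun i => v i, fun _ => rfl⟩
  have u0 : u 0 = v 0 := hu 0
  have u1 : u 1 = v 1 := hu 1
  have u2 : u 2 = v 2 := hu 2
  have u3 : u 3 = v 3 := hu 3
  have hex : ∀ x, ∃ i : Fin 4, H.Reachable (u i) x := by
    intro x
    obtain ⟨w⟩ := hconn.preconnected (u 0) x
    have : ∀ y z (w : G.Walk y z), (∃ i : Fin 4, H.Reachable (u i) y) →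
        ∃ i : Fin 4, H.Reachable (u i) z := by
      intro y z w
      induction w with
      | nil => exact id
      | @cons a b _ h w ih =>
        rintro ⟨i, hi⟩
        apply ih
        rcases (hG1 _ _).1 h with h | h
        · exact ⟨i, hi.trans h.reachable⟩
        · have : b = u 0 ∨ b = u 1 ∨ b = u 2 ∨ b = u 3 := by
            rw [u0, u1, u2, u3]
            simp only [Sym2.eq_iff] at h
            tauto
          rcases this with rfl | rfl | rfl | rfl
          exacts [⟨0, .refl _⟩, ⟨1, .refl _⟩, ⟨2, .refl _⟩, ⟨3, .refl _⟩]
    exact this _ _ w ⟨0, .refl _⟩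
  choose p hpr using hex
  have huniq : ∀ i j : Fin 4, H.Reachable (u i) (u j) → i = j := by
    intro i j h
    by_contra hne
    rw [hu, hu] at h
    exact hsep i i.2 j j.2 (fun h => hne (Fin.ext h)) h
  have hp : Comp H u p := by
    refine ⟨?_, hpr, ?_⟩
    · intro x y h
      exact huniq _ _ (((hpr x).trans h.reachable).trans (hpr y).symm)
    · intro i
      exact huniq _ _ (hpr (u i))
  have hK1 : IsGlue H u eps1 G := by
    intro x y
    rw [hG1, Fin.exists_fin_succ, Fin.exists_fin_succ, Fin.exists_fin_succ, Fin.exists_fin_succ]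
    simp [eps1, u0, u1, u2, u3]
  have hK2 : IsGlue H u eps2 G' := by
    have n30 : v 3 ≠ v 0 := g30.ne'.symm
    have n13 : v 1 ≠ v 3 := fun h => by simpa using hinj 1 (by norm_num) 3 (by norm_num) h
    have n01 : v 0 ≠ v 1 := g01.ne
    have n12 : v 1 ≠ v 2 := g12.ne
    have n23 : v 2 ≠ v 3 := g23.ne
    have n02 : v 0 ≠ v 2 := fun h => by simpa using hinj 0 (by norm_num) 2 (by norm_num) h
    intro x y
    have e2 : (∃ t, s(x, y) = s(u (eps2 t).1, u (eps2 t).2)) ↔ (s(x, y) = s(v 0, v 1) ∨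
        s(x, y) = s(v 1, v 2) ∨ s(x, y) = s(v 2, v 3) ∨ s(x, y) = s(v 1, v 3)) := by
      rw [Fin.exists_fin_succ, Fin.exists_fin_succ, Fin.exists_fin_succ, Fin.exists_fin_succ]
      simp [eps2, u0, u1, u2, u3]
    have hne : H.Adj x y → x ≠ y := fun h => h.ne
    rw [e2, hG', SimpleGraph.fromRel_adj, G.adj_comm y x, hG1 x y]
    have hh := hHadj x y
    have sw : s(y, x) = s(x, y) := Sym2.eq_swap
    have sw2 : s(v 3, v 0) = s(v 0, v 3) := Sym2.eq_swap
    rw [sw]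
    rw [sw2] at hh ⊢
    constructor
    · rintro ⟨-, (⟨h1, h3⟩ | ⟨rfl, rfl⟩) | (⟨h1, h3⟩ | ⟨rfl, rfl⟩)⟩
      · clear * - h1 h3; tauto
      · simp
      · clear * - h1 h3; tauto
      · simp
    · have d1 : s(v 0, v 1) ≠ s(v 0, v 3) := by
        rw [Ne, Sym2.eq_iff]; clear * - n13 n30 n01; tauto
      have d2 : s(v 1, v 2) ≠ s(v 0, v 3) := by
        rw [Ne, Sym2.eq_iff]; rintro (⟨h, -⟩ | ⟨h, -⟩)
        exacts [n01 h.symm, n13 h]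
      have d3 : s(v 2, v 3) ≠ s(v 0, v 3) := by
        rw [Ne, Sym2.eq_iff]; rintro (⟨h, -⟩ | ⟨h, -⟩)
        exacts [n02 h.symm, n23 h]
      have ne_of : ∀ a b, a ≠ b → s(x, y) = s(a, b) → x ≠ y := by
        intro a b hab h hxy
        subst hxy
        rcases Sym2.eq_iff.1 h with ⟨rfl, rfl⟩ | ⟨rfl, rfl⟩ <;> exact hab rfl
      rintro (h | h | h | h | h)
      · exact ⟨h.ne, Or.inl (Or.inl ⟨Or.inl h, fun h' => (hh.1 h).2 (by simp [h'])⟩)⟩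
      · exact ⟨ne_of _ _ n01 h, Or.inl (Or.inl ⟨by simp [h], by rw [h]; exact d1⟩)⟩
      · exact ⟨ne_of _ _ n12 h, Or.inl (Or.inl ⟨by simp [h], by rw [h]; exact d2⟩)⟩
      · exact ⟨ne_of _ _ n23 h, Or.inl (Or.inl ⟨by simp [h], by rw [h]; exact d3⟩)⟩
      · refine ⟨ne_of _ _ n13 h, ?_⟩
        rcases Sym2.eq_iff.1 h with h' | h'
        · exact Or.inl (Or.inr h')
        · exact Or.inr (Or.inr ⟨h'.2, h'.1⟩)
  have hm' : ∀ i : Fin 4, m i = (H.edgeFinset.filter (fun f => qq p f = i)).card := by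
    intro i
    rw [hm i i.2]
    congr 1
    apply Finset.filter_congr
    intro e he
    rw [SimpleGraph.mem_edgeFinset] at he
    induction e with | _ a b =>
    rw [SimpleGraph.mem_edgeSet] at he
    rw [qq_mk hp _ _ he, ← hu]
    constructor
    · intro h
      exact (huniq _ _ ((h a (by simp)).trans (hpr a).symm)).symm
    · rintro rfl x hx
      rcases Sym2.mem_iff.1 hx with rfl | rfl
      · exact hpr _
      · exact (hpr _).trans he.reachable
  have t1 := total data1 hp hK1 (fun i => m i) hm'
  have t2 := total data2 hp hK2 (fun i => m i) hm'
  have r1 : (∑ t, ∑ t', if t = t' then 0 else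
      min (min (cc1 (eps1 t).1 (eps1 t').1) (cc1 (eps1 t).1 (eps1 t').2))
        (min (cc1 (eps1 t).2 (eps1 t').1) (cc1 (eps1 t).2 (eps1 t').2)) + 1) = 16 := by decide
  have r2 : (∑ t, ∑ t', if t = t' then 0 else
      min (min (cc2 (eps2 t).1 (eps2 t').1) (cc2 (eps2 t).1 (eps2 t').2))
        (min (cc2 (eps2 t).2 (eps2 t').1) (cc2 (eps2 t).2 (eps2 t').2)) + 1) = 14 := by decide
  have s1 : ∀ i, ∑ t, min (cc1 i (eps1 t).1) (cc1 i (eps1 t).2) = 2 := by decide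
  have s2 : ∀ i, ∑ t, min (cc2 i (eps2 t).1) (cc2 i (eps2 t).2) = (![4, 1, 2, 2] : Fin 4 → ℕ) i := by
    decide
  rw [r1] at t1
  rw [r2] at t2
  simp only [s1] at t1
  simp only [s2] at t2
  simp [Fin.sum_univ_four, cc1] at t1
  simp [Fin.sum_univ_four, cc2] at t2
  have key : (edgeWiener G' : ℤ) - (edgeWiener G : ℤ)
        = ((m 0 : ℤ) - m 1) * m 3 + 2 * m 0 - m 1 - 1 := by
    unfold edgeWiener
    have hd : ((∑ e ∈ G'.edgeFinset, ∑ f ∈ G'.edgeFinset, eDist G' e f : ℕ) : ℤ) =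
        (∑ e ∈ G.edgeFinset, ∑ f ∈ G.edgeFinset, eDist G e f : ℕ)
        + 2 * (((m 0 : ℤ) - m 1) * m 3 + 2 * m 0 - m 1 - 1) := by
      rw [t1, t2]
      push_cast
      ring
    generalize (∑ e ∈ G'.edgeFinset, ∑ f ∈ G'.edgeFinset, eDist G' e f) = A at *
    generalize (∑ e ∈ G.edgeFinset, ∑ f ∈ G.edgeFinset, eDist G e f) = B at *
    omega
  have a0 := hm1 0 (by norm_num)
  have a1 := hm1 1 (by norm_num)
  have a2 := hm1 2 (by norm_num)
  have a3 := hm1 3 (by norm_num)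
  have b1 := hmax 1 (by norm_num)
  have b2 := hmax 2 (by norm_num)
  have b3 := hmax 3 (by norm_num)
  have hnn : 0 ≤ ((m 0 : ℤ) - m 1) * m 3 := mul_nonneg (by omega) (by omega)
  refine ⟨key, by omega, ?_, ?_⟩
  · intro h
    omega
  · rintro ⟨h0, h1, h2, h3⟩
    rw [h0, h1, h3] at key
    push_cast at key
    omega
end
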